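/- arXiv:1304.6510 — 2 statements merged into one kernel-verified Lean document; each statement's English description precedes it below -/
import Mathlib

section
/- For every integer t ≥ 1, every K_{t+1}-minor-free graph on n vertices has an independent set of size α satisfying (2α − 1)·t ≥ n. -/
/-- `H` is a minor of `G`: there is a family of nonempty, pairwise disjoint,
connected branch sets in `G`, one for each vertex of `H`, such that adjacent
vertices of `H` have adjacent branch sets. -/
def SimpleGraph.IsMinorOf {W V : Type*} (H : SimpleGraph W) (G : SimpleGraph V) : Prop :=
  ∃ B : W → Set V,
    (∀ w, (B w).Nonempty) ∧
    (∀ w, (G.induce (B w)).Connected) ∧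
    (Pairwise fun w₁ w₂ => Disjoint (B w₁) (B w₂)) ∧
    ∀ ⦃w₁ w₂⦄, H.Adj w₁ w₂ → ∃ v₁ ∈ B w₁, ∃ v₂ ∈ B w₂, G.Adj v₁ v₂

/-- `G` has no `K_t`-minor (`K_t` is the complete graph on `t` vertices). -/
def SimpleGraph.KMinorFree {V : Type*} (G : SimpleGraph V) (t : ℕ) : Prop :=
  ¬ (completeGraph (Fin t)).IsMinorOf G

namespace SimpleGraph

variable {V : Type*} {G : SimpleGraph V}

/-- `U` contains the branch sets of a `K_t`-minor of `G`. -/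
def HasCompleteMinorIn (G : SimpleGraph V) (U : Set V) (t : ℕ) : Prop :=
  ∃ B : Fin t → Set V,
    (∀ i, B i ⊆ U) ∧
    (∀ i, (G.induce (B i)).Connected) ∧
    (Pairwise fun i j => Disjoint (B i) (B j)) ∧
    ∀ ⦃i j⦄, i ≠ j → ∃ v ∈ B i, ∃ w ∈ B j, G.Adj v w

theorem HasCompleteMinorIn.mono {U W : Set V} {t : ℕ} (h : G.HasCompleteMinorIn U t)
    (hUW : U ⊆ W) : G.HasCompleteMinorIn W t := by
  obtain ⟨B, hB, h⟩ := h
  exact ⟨B, fun i => (hB i).trans hUW, h⟩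

theorem HasCompleteMinorIn.isMinorOf {U : Set V} {t : ℕ} (h : G.HasCompleteMinorIn U t) :
    (completeGraph (Fin t)).IsMinorOf G := by
  obtain ⟨B, -, hc, hd, ha⟩ := h
  exact ⟨B, fun i => Set.nonempty_coe_sort.1 (hc i).nonempty, hc, hd, fun i j hij => ha hij⟩

theorem connected_induce_singleton (v : V) : (G.induce {v}).Connected :=
  { preconnected := .of_subsingleton
    nonempty := ⟨⟨v, rfl⟩⟩ }

theorem hasCompleteMinorIn_one {U : Set V} {v : V} (hv : v ∈ U) : G.HasCompleteMinorIn U 1 :=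
  ⟨fun _ => {v}, fun _ => Set.singleton_subset_iff.2 hv, fun _ => connected_induce_singleton v,
    fun _ _ hij => (hij (Subsingleton.elim _ _)).elim,
    fun _ _ hij => (hij (Subsingleton.elim _ _)).elim⟩

theorem HasCompleteMinorIn.succ_of_dominating {U D : Set V} {t : ℕ}
    (h : G.HasCompleteMinorIn (U \ D) t) (hDU : D ⊆ U) (hD : (G.induce D).Connected)
    (hdom : ∀ v ∈ U \ D, ∃ d ∈ D, G.Adj v d) : G.HasCompleteMinorIn U (t + 1) := by
  obtain ⟨B, hB, hc, hd, ha⟩ := h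
  have hdisj (i) : Disjoint D (B i) := Set.disjoint_sdiff_right.mono_right (hB i)
  have hadj (i) : ∃ v ∈ B i, ∃ d ∈ D, G.Adj v d := by
    obtain ⟨v, hv⟩ := (hc i).nonempty
    exact ⟨v, hv, hdom v (hB i hv)⟩
  refine ⟨Fin.cons D B, Fin.cases hDU fun i => (hB i).trans Set.sdiff_subset, Fin.cases hD hc,
    fun i j hij => ?_, fun i j hij => ?_⟩
  · induction i using Fin.cases <;> induction j using Fin.cases
    · exact (hij rfl).elim
    · exact hdisj _
    · exact (hdisj _).symm
    · exact hd fun h => hij (congrArg Fin.succ h)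
  · induction i using Fin.cases <;> induction j using Fin.cases
    · exact (hij rfl).elim
    · obtain ⟨v, hv, d, hd, h⟩ := hadj _
      exact ⟨d, hd, v, hv, h.symm⟩
    · exact hadj _
    · exact ha fun h => hij (congrArg Fin.succ h)

/-- A maximal connected set built from an independent set by two-vertex extensions dominates a
set `C` that has no edge to the rest of `U`. -/
theorem exists_connected_dominating_indep [DecidableEq V] {U : Finset V} (hU : U.Nonempty) :
    ∃ C D S : Finset V, S ⊆ D ∧ D ⊆ C ∧ C ⊆ U ∧ G.IsIndepSet S ∧ (G.induce (D : Set V)).Connected ∧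
      D.card + 1 ≤ 2 * S.card ∧ (∀ v ∈ C \ D, ∃ d ∈ D, G.Adj v d) ∧
      ∀ v ∈ C, ∀ w ∈ U \ C, ¬ G.Adj v w := by
  classical
  let P (D : Finset V) : Prop := (G.induce (D : Set V)).Connected ∧
    ∃ S ⊆ D, G.IsIndepSet S ∧ D.card + 1 ≤ 2 * S.card
  obtain ⟨u, hu⟩ := hU
  have hne : (U.powerset.filter P).Nonempty := by
    refine ⟨{u}, Finset.mem_filter.2 ⟨by simpa using hu, ?_, {u}, subset_rfl, ?_, by simp⟩⟩
    · rw [Finset.coe_singleton]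
      exact connected_induce_singleton u
    · simp [IsIndepSet]
  obtain ⟨D, hD, hmax⟩ := Finset.exists_max_image _ Finset.card hne
  obtain ⟨hDU, hconn, S, hSD, hS, hcard⟩ := by simpa only [Finset.mem_filter, P] using hD
  rw [Finset.mem_powerset] at hDU
  refine ⟨D ∪ U.filter fun v => ∃ d ∈ D, G.Adj v d, D, S, hSD, Finset.subset_union_left,
    Finset.union_subset hDU (Finset.filter_subset _ _), hS, hconn, hcard, by grind, ?_⟩
  intro v hv w hw hvw
  simp only [Finset.mem_sdiff, Finset.mem_union, Finset.mem_filter, not_or, not_and] at hv hw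
  obtain ⟨hwU, hwD, hwN⟩ := hw
  have hwN' (d) (hd : d ∈ D) : ¬ G.Adj w d := fun h => hwN hwU ⟨d, hd, h⟩
  have hvD : v ∉ D := fun h => hwN' v h hvw.symm
  obtain ⟨hvU, d, hd, hvd⟩ := hv.resolve_left hvD
  have hcardD : (D ∪ {v, w}).card = D.card + 2 := by
    rw [Finset.card_union_of_disjoint (by simp [hvD, hwD]), Finset.card_pair hvw.ne]
  have hwS : w ∉ S := fun h => hwD (hSD h)
  have hmem : D ∪ {v, w} ∈ U.powerset.filter P := by
    refine Finset.mem_filter.2 ⟨by grind, ?_, insert w S, by grind, ?_, ?_⟩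
    · rw [Finset.coe_union, Finset.coe_pair]
      exact connected_induce_union (v := d) (w := v) hconn.preconnected
        (induce_pair_connected_of_adj hvw).preconnected hd (by simp) hvd.symm
    · rw [Finset.coe_insert]
      exact hS.insert fun b hb _ =>
        ⟨hwN' b (hSD hb), fun h => hwN' b (hSD hb) h.symm⟩
    · rw [hcardD, Finset.card_insert_of_notMem hwS]
      lia
  have := hmax _ hmem
  lia

theorem exists_isIndepSet_of_not_hasCompleteMinorIn (t : ℕ) (U : Finset V)
    (hU : ¬ G.HasCompleteMinorIn U (t + 1)) :
    ∃ S ⊆ U, G.IsIndepSet S ∧ U.card ≤ (2 * S.card - 1) * t := by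
  classical
  induction t generalizing U with
  | zero =>
    have : U = ∅ := Finset.eq_empty_of_forall_notMem fun v hv => hU (hasCompleteMinorIn_one hv)
    exact ⟨∅, by simp, by simp [IsIndepSet], by simp [this]⟩
  | succ t iht =>
    induction U using Finset.strongInduction with
    | H U ihU =>
    obtain rfl | hne := U.eq_empty_or_nonempty
    · exact ⟨∅, by simp, by simp [IsIndepSet], by simp⟩
    obtain ⟨C, D, S, hSD, hDC, hCU, hS, hD, hcard, hdom, hsep⟩ :=
      exists_connected_dominating_indep (G := G) hne
    obtain rfl | hCU' := hCU.eq_or_ssubset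
    · obtain ⟨S', hS'C, hS', hcard'⟩ := iht (C \ D) fun h => hU <| by
        rw [Finset.coe_sdiff] at h
        exact h.succ_of_dominating (by exact_mod_cast hDC) hD (by simpa using hdom)
      have hsum := Finset.card_sdiff_add_card_eq_card hDC
      obtain hle | hle := le_total S.card S'.card
      · refine ⟨S', hS'C.trans Finset.sdiff_subset, hS', ?_⟩
        rw [mul_add_one]
        lia
      · refine ⟨S, hSD.trans hDC, hS, ?_⟩
        have : (2 * S'.card - 1) * t ≤ (2 * S.card - 1) * t := by gcongr
        rw [mul_add_one]
        lia
    · have hCne : C.Nonempty := by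
        obtain ⟨d, hd⟩ := hD.nonempty
        exact ⟨d, hDC hd⟩
      obtain ⟨A, hAC, hA, hcardA⟩ :=
        ihU C hCU' fun h => hU (h.mono (by exact_mod_cast hCU))
      obtain ⟨B, hBC, hB, hcardB⟩ :=
        ihU (U \ C) (Finset.sdiff_ssubset hCU hCne) fun h => hU (h.mono (by simp))
      have hsum := Finset.card_sdiff_add_card_eq_card hCU
      have hAB : Disjoint A B := Finset.disjoint_sdiff.mono hAC hBC
      refine ⟨A ∪ B, by grind, ?_, ?_⟩
      · rw [Finset.coe_union, IsIndepSet, Set.pairwise_union]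
        exact ⟨hA, hB, fun a ha b hb _ =>
          ⟨hsep a (hAC ha) b (hBC hb), fun h => hsep a (hAC ha) b (hBC hb) h.symm⟩⟩
      · rw [Finset.card_union_of_disjoint hAB]
        calc U.card ≤ (2 * A.card - 1 + (2 * B.card - 1)) * (t + 1) := by rw [add_mul]; lia
          _ ≤ (2 * (A.card + B.card) - 1) * (t + 1) := by gcongr; lia

end SimpleGraph

/-- Duchet–Meyniel: every `K_{t+1}`-minor-free graph on `n` vertices has an
independent set of size `α` with `(2α - 1) * t ≥ n`. -/
theorem indep_bound_duchet_meyniel (t : ℕ) (ht : 1 ≤ t)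
    (V : Type) [Fintype V] (G : SimpleGraph V) (hG : G.KMinorFree (t + 1)) :
    ∃ (α : ℕ) (S : Finset V), S.card = α ∧
      (∀ v ∈ S, ∀ w ∈ S, v ≠ w → ¬ G.Adj v w) ∧
      Fintype.card V ≤ (2 * α - 1) * t := by
  obtain ⟨S, -, hS, hcard⟩ := G.exists_isIndepSet_of_not_hasCompleteMinorIn t Finset.univ
    fun h => hG h.isMinorOf
  exact ⟨S.card, S, rfl, fun v hv w hw hvw => hS hv hw hvw, hcard⟩
end

section
/- Fix an integer t ≥ 6. Assume that every K_{t+1}-minor-free graph has minimum degree at most δ. Then every K_{t+1}-minor-free graph G satisfies χ(G) ≤ δ − (2δ − 5)/(4t − 14) + 3/2. -/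
namespace SimpleGraph

variable {V : Type*}

/-- A model of the complete graph on `n` vertices in `G` whose branch sets lie in `A` and
meet `T`. -/
def CliqueModel (G : SimpleGraph V) (n : ℕ) (A T : Set V) : Prop :=
  ∃ B : Fin n → Set V,
    (∀ i, (G.induce (B i)).Connected) ∧ (∀ i, B i ⊆ A) ∧ (∀ i, (B i ∩ T).Nonempty) ∧
    (Pairwise fun i j => Disjoint (B i) (B j)) ∧
    Pairwise fun i j => ∃ x ∈ B i, ∃ y ∈ B j, G.Adj x y

theorem cliqueModel_zero (G : SimpleGraph V) (A T : Set V) : G.CliqueModel 0 A T :=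
  ⟨fun _ => ∅, fun i => i.elim0, fun i => i.elim0, fun i => i.elim0, fun i => i.elim0,
    fun i => i.elim0⟩

theorem CliqueModel.extend {G : SimpleGraph V} {n : ℕ} {A T A' T' C : Set V}
    (h : G.CliqueModel n A T) (hA : A ⊆ A') (hT : T ⊆ T') (hC : (G.induce C).Connected)
    (hCA : C ⊆ A') (hCT : (C ∩ T').Nonempty) (hdisj : Disjoint C A)
    (hadj : ∀ x ∈ T, ∃ y ∈ C, G.Adj y x) : G.CliqueModel (n + 1) A' T' := by
  obtain ⟨B, hB, hBA, hBT, hBd, hBadj⟩ := h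
  refine ⟨Fin.cons C B, ?_, ?_, ?_, ?_, ?_⟩
  · intro i
    refine Fin.cases ?_ (fun j => ?_) i
    · exact hC
    · exact hB j
  · intro i
    refine Fin.cases ?_ (fun j => ?_) i
    · exact hCA
    · exact (hBA j).trans hA
  · intro i
    refine Fin.cases ?_ (fun j => ?_) i
    · exact hCT
    · exact (hBT j).mono (Set.inter_subset_inter_right _ hT)
  · intro i j
    refine Fin.cases ?_ (fun i => ?_) i <;> refine Fin.cases ?_ (fun j => ?_) j
    · intro h; exact absurd rfl h
    · intro _; exact hdisj.mono_right (hBA j)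
    · intro _; exact (hdisj.mono_right (hBA i)).symm
    · intro h; exact hBd (fun e => h (congrArg Fin.succ e))
  · intro i j
    refine Fin.cases ?_ (fun i => ?_) i <;> refine Fin.cases ?_ (fun j => ?_) j
    · intro h; exact absurd rfl h
    · intro _
      obtain ⟨x, hx, hxT⟩ := hBT j
      obtain ⟨y, hy, hyx⟩ := hadj x hxT
      exact ⟨y, hy, x, hx, hyx⟩
    · intro _
      obtain ⟨x, hx, hxT⟩ := hBT i
      obtain ⟨y, hy, hyx⟩ := hadj x hxT
      exact ⟨x, hx, y, hy, hyx.symm⟩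
    · intro h; exact hBadj (fun e => h (congrArg Fin.succ e))

theorem CliqueModel.not_kMinorFree {G : SimpleGraph V} {n : ℕ} {A T : Set V}
    (h : G.CliqueModel n A T) : ¬ G.KMinorFree n := by
  obtain ⟨B, hB, -, hBT, hBd, hBadj⟩ := h
  exact fun hG => hG ⟨B, fun i => (hBT i).mono Set.inter_subset_left, hB, hBd,
    fun i j hij => hBadj hij.ne⟩

theorem connected_induce_singleton_s4 (G : SimpleGraph V) (x : V) :
    (G.induce {x}).Connected := by
  have : Nonempty ({x} : Set V) := ⟨⟨x, rfl⟩⟩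
  exact ⟨.of_subsingleton⟩

/-- A clique gives a model of a complete graph by singletons. -/
theorem IsClique.cliqueModel {G : SimpleGraph V} (s : Finset V) (hs : G.IsClique (s : Set V)) :
    G.CliqueModel s.card s s := by
  classical
  induction s using Finset.induction_on with
  | empty => exact cliqueModel_zero _ _ _
  | insert a s ha ih =>
    rw [Finset.card_insert_of_notMem ha]
    refine (ih (hs.subset (by simp))).extend (C := {a}) (by simp) (by simp)
      (connected_induce_singleton_s4 G a) (by simp) ⟨a, by simp⟩ (by simpa using ha) ?_
    intro x hx
    exact ⟨a, rfl, hs (by simp) (by simp [Finset.mem_coe.1 hx]) (by rintro rfl; exact ha hx)⟩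

/-- If every point of `s` is reached from `u` by a walk of `G` inside `s`, then `s` is
connected. -/
theorem connected_induce_of_walks {G : SimpleGraph V} {s : Set V} (u : V) (hu : u ∈ s)
    (h : ∀ z ∈ s, ∃ p : G.Walk u z, ∀ y ∈ p.support, y ∈ s) : (G.induce s).Connected := by
  refine induce_connected_of_patches u hu fun {z} hz => ?_
  obtain ⟨p, hp⟩ := h z hz
  exact ⟨{y | y ∈ p.support}, hp, p.start_mem_support, p.end_mem_support,
    (p.connected_induce_support).preconnected _ _⟩

theorem exists_walk_of_connected_induce {G : SimpleGraph V} {s : Set V}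
    (h : (G.induce s).Connected) {x y : V} (hx : x ∈ s) (hy : y ∈ s) :
    ∃ p : G.Walk x y, ∀ z ∈ p.support, z ∈ s := by
  obtain ⟨p⟩ := h.preconnected ⟨x, hx⟩ ⟨y, hy⟩
  refine ⟨p.map (Embedding.induce s).toHom, fun z hz => ?_⟩
  have hz : z ∈ (p.map (Embedding.induce s).toHom).support := hz
  rw [Walk.support_map, List.mem_map] at hz
  obtain ⟨a, -, rfl⟩ := hz
  exact a.2

/-- A walk of a subgraph starting at `x` runs through points reachable from `x`. -/
theorem Reachable.exists_walk {G K : SimpleGraph V} (hK : K ≤ G) {x z : V}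
    (h : K.Reachable x z) : ∃ p : G.Walk x z, ∀ y ∈ p.support, K.Reachable x y := by
  classical
  obtain ⟨p⟩ := h
  refine ⟨p.mapLe hK, fun y hy => ?_⟩
  rw [Walk.support_mapLe_eq_support] at hy
  exact ⟨p.takeUntil y hy⟩

theorem IsMinorOf.trans {U W V : Type*} {H : SimpleGraph U} {G' : SimpleGraph W}
    {G : SimpleGraph V} (h₁ : H.IsMinorOf G') (h₂ : G'.IsMinorOf G) : H.IsMinorOf G := by
  obtain ⟨B, hBn, hBc, hBd, hBa⟩ := h₁
  obtain ⟨C, hCn, hCc, hCd, hCa⟩ := h₂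
  refine ⟨fun u => ⋃ w ∈ B u, C w, fun u => ?_, fun u => ?_, fun u₁ u₂ hu => ?_,
    fun u₁ u₂ hu => ?_⟩
  · obtain ⟨w, hw⟩ := hBn u
    obtain ⟨x, hx⟩ := hCn w
    exact ⟨x, Set.mem_biUnion hw hx⟩
  · have key : ∀ w₁ w₂ : W, ∀ p : G'.Walk w₁ w₂, (∀ w ∈ p.support, w ∈ B u) →
        ∀ x ∈ C w₁, ∀ z ∈ C w₂, ∃ q : G.Walk x z, ∀ y ∈ q.support, y ∈ ⋃ w ∈ B u, C w := by
      intro w₁ w₂ p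
      induction p with
      | nil =>
        intro hp x hx z hz
        obtain ⟨q, hq⟩ := exists_walk_of_connected_induce (hCc _) hx hz
        exact ⟨q, fun y hy => Set.mem_biUnion (hp _ (by simp)) (hq y hy)⟩
      | @cons a b d hab p ih =>
        intro hp x hx z hz
        obtain ⟨a', ha', b', hb', hadj⟩ := hCa hab
        obtain ⟨q, hq⟩ := exists_walk_of_connected_induce (hCc _) hx ha'
        obtain ⟨r, hr⟩ := ih (fun w hw => hp w (by simp [hw])) b' hb' z hz
        refine ⟨q.append (Walk.cons hadj r), fun y hy => ?_⟩
        rw [Walk.mem_support_append_iff, Walk.support_cons, List.mem_cons] at hy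
        rcases hy with hy | rfl | hy
        · exact Set.mem_biUnion (hp a (by simp)) (hq y hy)
        · exact Set.mem_biUnion (hp a (by simp)) ha'
        · exact hr y hy
    obtain ⟨w, hw⟩ := hBn u
    obtain ⟨x, hx⟩ := hCn w
    refine connected_induce_of_walks x (Set.mem_biUnion hw hx) fun z hz => ?_
    obtain ⟨w', hw', hz⟩ := Set.mem_iUnion₂.1 hz
    obtain ⟨p, hp⟩ := exists_walk_of_connected_induce (hBc u) hw hw'
    exact key w w' p hp x hx z hz
  · simp only [Set.disjoint_iUnion_left, Set.disjoint_iUnion_right]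
    intro w₁ hw₁ w₂ hw₂
    exact hCd fun e => Set.disjoint_left.1 (hBd hu) hw₂ (e ▸ hw₁)
  · obtain ⟨w₁, hw₁, w₂, hw₂, hw⟩ := hBa hu
    obtain ⟨x₁, hx₁, x₂, hx₂, hx⟩ := hCa hw
    exact ⟨x₁, Set.mem_biUnion hw₁ hx₁, x₂, Set.mem_biUnion hw₂ hx₂, hx⟩

/-- The subgraph of `G - v` spanned by the vertices coloured `a` or `b`. -/
def kempe {α : Type*} (G : SimpleGraph V) (v : V) (c : V → α) (a b : α) : SimpleGraph V where
  Adj x y := G.Adj x y ∧ (x ≠ v ∧ (c x = a ∨ c x = b)) ∧ (y ≠ v ∧ (c y = a ∨ c y = b))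
  symm := ⟨fun _ _ h => ⟨h.1.symm, h.2.2, h.2.1⟩⟩
  loopless := ⟨fun _ h => h.1.ne rfl⟩

theorem kempe_le {α : Type*} (G : SimpleGraph V) (v : V) (c : V → α) (a b : α) :
    G.kempe v c a b ≤ G := fun _ _ h => h.1

theorem kempe_reachable_imp {α : Type*} {G K : SimpleGraph V} {v : V} {c : V → α} {a b : α}
    (hK : K ≤ G.kempe v c a b) {x z : V}
    (hx : x ≠ v ∧ (c x = a ∨ c x = b)) (h : K.Reachable x z) :
    z ≠ v ∧ (c z = a ∨ c z = b) := by
  obtain ⟨p⟩ := h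
  induction p with
  | nil => exact hx
  | cons h p ih => exact ih (hK h).2.2

/-- If the colours of `x` and `y` each occur once around the uncoloured vertex `v`, then either
`v` can be coloured after a Kempe change, or `x` and `y` are joined by a Kempe chain. -/
theorem kempe_reachable_of_not_colorable {k : ℕ} {G : SimpleGraph V} {v : V} {c : V → Fin k}
    (hG : ¬ G.Colorable k)
    (hc : ∀ x y, x ≠ v → y ≠ v → G.Adj x y → c x ≠ c y) {x y : V}
    (hx : ∀ z, G.Adj v z → c z = c x → z = x)
    (hy : ∀ z, G.Adj v z → c z = c y → z = y) :
    (G.kempe v c (c x) (c y)).Reachable x y := by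
  classical
  by_contra hxy
  set K := G.kempe v c (c x) (c y)
  let d : V → Fin k := fun z => if K.Reachable x z then Equiv.swap (c x) (c y) (c z) else c z
  have hd : ∀ a b, a ≠ v → b ≠ v → G.Adj a b → d a ≠ d b := by
    intro a b ha hb hab
    have hcab := hc a b ha hb hab
    have key : ∀ a b, a ≠ v → b ≠ v → G.Adj a b → K.Reachable x a → ¬ K.Reachable x b →
        Equiv.swap (c x) (c y) (c a) ≠ c b := by
      intro a b ha hb hab hra hrb e
      have hcab := hc a b ha hb hab
      have hkb : ¬ ((c a = c x ∨ c a = c y) ∧ (c b = c x ∨ c b = c y)) := fun h =>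
        hrb (hra.trans (Adj.reachable (⟨hab, ⟨ha, h.1⟩, hb, h.2⟩ : K.Adj a b)))
      by_cases h1 : c a = c x
      · rw [h1, Equiv.swap_apply_left] at e
        exact hkb ⟨Or.inl h1, Or.inr e.symm⟩
      by_cases h2 : c a = c y
      · rw [h2, Equiv.swap_apply_right] at e
        exact hkb ⟨Or.inr h2, Or.inl e.symm⟩
      rw [Equiv.swap_apply_of_ne_of_ne h1 h2] at e
      exact hcab e
    by_cases h1 : K.Reachable x a <;> by_cases h2 : K.Reachable x b
    · simpa [d, h1, h2] using hcab
    · simpa [d, h1, h2] using key a b ha hb hab h1 h2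
    · simpa [d, h1, h2] using (key b a hb ha hab.symm h2 h1).symm
    · simpa [d, h1, h2] using hcab
  have hdv : ∀ z, G.Adj v z → d z ≠ c x := by
    intro z hz e
    by_cases h : K.Reachable x z
    · simp only [d, h, if_true] at e
      rw [Equiv.swap_apply_eq_iff, Equiv.swap_apply_left] at e
      exact hxy (hy z hz e ▸ h)
    · simp only [d, h, if_false] at e
      exact h (hx z hz e ▸ Reachable.refl _)
  refine hG ⟨Coloring.mk (fun z => if z = v then c x else d z) fun {a b} hab => ?_⟩
  by_cases ha : a = v <;> by_cases hb : b = v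
  · exact absurd (ha.trans hb.symm) hab.ne
  · subst ha; simpa [hb] using (hdv b hab).symm
  · subst hb; simpa [ha] using hdv a hab.symm
  · simpa [ha, hb] using hd a b ha hb hab

/-- Kempe chains between the vertices of `J` connect `J`. -/
theorem connected_induce_kempe {α : Type*} {G : SimpleGraph V} {v : V} {c : V → α} {J : Set V}
    (hJ : J.Nonempty)
    (hch : ∀ x ∈ J, ∀ y ∈ J, (G.kempe v c (c x) (c y)).Reachable x y) :
    (G.induce {z | ∃ x ∈ J, ∃ y ∈ J, (G.kempe v c (c x) (c y)).Reachable x z}).Connected := by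
  obtain ⟨u, hu⟩ := hJ
  refine connected_induce_of_walks u ⟨u, hu, u, hu, Reachable.refl _⟩ ?_
  rintro z ⟨x, hx, y, hy, hz⟩
  obtain ⟨p, hp⟩ := (hch u hu x hx).exists_walk (kempe_le _ _ _ _ _)
  obtain ⟨q, hq⟩ := hz.exists_walk (kempe_le _ _ _ _ _)
  refine ⟨p.append q, fun w hw => ?_⟩
  rcases (Walk.mem_support_append_iff _ _).1 hw with hw | hw
  · exact ⟨u, hu, x, hx, hp w hw⟩
  · exact ⟨x, hx, y, hy, hq w hw⟩

theorem Walk.exists_walk_avoiding_end {K : SimpleGraph V} {z x : V} (p : K.Walk z x)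
    (hzx : z ≠ x) : ∃ w, K.Adj w x ∧ ∃ q : K.Walk z w, x ∉ q.support := by
  induction p with
  | nil => exact absurd rfl hzx
  | @cons a b d h p ih =>
    by_cases hb : b = d
    · subst hb
      exact ⟨a, h, Walk.nil, by simpa using hzx.symm⟩
    · obtain ⟨w, hw, q, hq⟩ := ih hb
      exact ⟨w, hw, Walk.cons h q, by simp [hq, hzx.symm]⟩

/-- An edge `xy` and a vertex `z` joined to both ends by Kempe chains give a triangle model. -/
theorem cliqueModel_three_of_kempe {α : Type*} {G : SimpleGraph V} {v : V} {c : V → α}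
    {x y z : V} (hx : x ≠ v) (hy : y ≠ v) (hz : z ≠ v) (hxy : G.Adj x y)
    (cxy : c x ≠ c y) (cxz : c x ≠ c z) (cyz : c y ≠ c z)
    (hzx : (G.kempe v c (c z) (c x)).Reachable z x)
    (hzy : (G.kempe v c (c z) (c y)).Reachable z y) :
    G.CliqueModel 3 {w | w ≠ v ∧ (c w = c x ∨ c w = c y ∨ c w = c z)} {x, y, z} := by
  classical
  have h1 : G.CliqueModel 1 {x} {x} :=
    (cliqueModel_zero G ∅ ∅).extend (C := {x}) (by simp) (by simp)
      (connected_induce_singleton_s4 G x) subset_rfl ⟨x, by simp⟩ (by simp) (by simp)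
  have h2 : G.CliqueModel 2 {x, y} {x, y} :=
    h1.extend (C := {y}) (by simp) (by simp) (connected_induce_singleton_s4 G y) (by simp)
      ⟨y, by simp⟩ (by simpa using hxy.ne.symm) (by simpa using hxy.symm)
  set P : V → V → Prop := fun x u => ∃ p : (G.kempe v c (c z) (c x)).Walk z u, x ∉ p.support
  have hnx : z ≠ x := fun e => cxz (by rw [e])
  have hny : z ≠ y := fun e => cyz (by rw [e])
  have hPc : ∀ x u, P x u → u ≠ v ∧ (c u = c z ∨ c u = c x) := by
    rintro x u ⟨p, -⟩
    exact kempe_reachable_imp le_rfl ⟨hz, Or.inl rfl⟩ ⟨p⟩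
  have hPne : ∀ x u, P x u → u ≠ x := by
    rintro x u ⟨p, hp⟩ rfl
    exact hp p.end_mem_support
  have hPw : ∀ x u, P x u → ∃ p : G.Walk z u, ∀ w ∈ p.support, P x w := by
    rintro x u ⟨p, hp⟩
    refine ⟨p.mapLe (kempe_le _ _ _ _ _), fun w hw => ?_⟩
    rw [Walk.support_mapLe_eq_support] at hw
    exact ⟨p.takeUntil w hw, fun h => hp (p.support_takeUntil_subset_support hw h)⟩
  have hPadj : ∀ x, z ≠ x → (G.kempe v c (c z) (c x)).Reachable z x → ∃ w, P x w ∧ G.Adj w x := by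
    rintro x hne ⟨p⟩
    obtain ⟨w, hw, q, hq⟩ := p.exists_walk_avoiding_end hne
    exact ⟨w, ⟨q, hq⟩, hw.1⟩
  have hzP : P x z := ⟨Walk.nil, by simpa using hnx.symm⟩
  refine h2.extend (C := {u | P x u ∨ P y u}) ?_ ?_ ?_ ?_ ⟨z, Or.inl hzP, by simp⟩ ?_ ?_
  · rintro w (rfl | rfl)
    · exact ⟨hx, Or.inl rfl⟩
    · exact ⟨hy, Or.inr (Or.inl rfl)⟩
  · rintro w (rfl | rfl) <;> simp
  · refine connected_induce_of_walks z (Or.inl hzP) ?_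
    rintro u (hu | hu)
    · obtain ⟨p, hp⟩ := hPw _ _ hu
      exact ⟨p, fun w hw => Or.inl (hp w hw)⟩
    · obtain ⟨p, hp⟩ := hPw _ _ hu
      exact ⟨p, fun w hw => Or.inr (hp w hw)⟩
  · rintro u (hu | hu)
    · exact ⟨(hPc _ _ hu).1, by have := (hPc _ _ hu).2; tauto⟩
    · exact ⟨(hPc _ _ hu).1, by have := (hPc _ _ hu).2; tauto⟩
  · rw [Set.disjoint_left]
    rintro u (hu | hu) (rfl | rfl)
    · exact hPne _ _ hu rfl
    · rcases (hPc _ _ hu).2 with h | h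
      · exact cyz h
      · exact cxy h.symm
    · rcases (hPc _ _ hu).2 with h | h
      · exact cxz h
      · exact cxy h
    · exact hPne _ _ hu rfl
  · rintro u (rfl | rfl)
    · obtain ⟨w, hw, hwx⟩ := hPadj _ hnx hzx
      exact ⟨w, Or.inl hw, hwx⟩
    · obtain ⟨w, hw, hwx⟩ := hPadj _ hny hzy
      exact ⟨w, Or.inr hw, hwx⟩

theorem CliqueModel.mono {G : SimpleGraph V} {n : ℕ} {A T A' T' : Set V}
    (h : G.CliqueModel n A T) (hA : A ⊆ A') (hT : T ⊆ T') : G.CliqueModel n A' T' := by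
  obtain ⟨B, hB, hBA, hBT, hBd, hBadj⟩ := h
  exact ⟨B, hB, fun i => (hBA i).trans hA,
    fun i => (hBT i).mono (Set.inter_subset_inter_right _ hT), hBd, hBadj⟩

/-- If the vertices of `S` have distinct colours, are pairwise joined by Kempe chains, and span no
independent set of more than `β` vertices, then `S` and its Kempe chains contain a large clique
minor. -/
theorem cliqueModel_of_kempe {α : Type*} {G : SimpleGraph V} {v : V} {c : V → α} {β : ℕ}
    (hβ : 2 ≤ β) (r : ℕ) (S : Finset V) (hSv : ∀ x ∈ S, x ≠ v) (hinj : Set.InjOn c S)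
    (hch : ∀ x ∈ S, ∀ y ∈ S, (G.kempe v c (c x) (c y)).Reachable x y)
    (hα : ∀ J ⊆ S, G.IsIndepSet (J : Set V) → J.card ≤ β)
    (hcard : r * β + β + 1 ≤ S.card) :
    G.CliqueModel (r + 3) {z | z ≠ v ∧ c z ∈ c '' S} S := by
  classical
  induction r generalizing S with
  | zero =>
    have hS : ¬ G.IsIndepSet (S : Set V) := fun h => by
      have := hα S subset_rfl h
      omega
    obtain ⟨x, hx, y, hy, hxy⟩ : ∃ x ∈ S, ∃ y ∈ S, G.Adj x y := by
      by_contra hcon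
      push Not at hcon
      exact hS fun x hx y hy _ => hcon x hx y hy
    obtain ⟨z, hz, hzn⟩ : ∃ z ∈ S, z ∉ ({x, y} : Finset V) :=
      Finset.exists_mem_notMem_of_card_lt_card
        (lt_of_le_of_lt (Finset.card_le_two) (by omega))
    simp only [Finset.mem_insert, Finset.mem_singleton, not_or] at hzn
    refine (cliqueModel_three_of_kempe (hSv x hx) (hSv y hy) (hSv z hz) hxy
      (fun e => hxy.ne (hinj hx hy e)) (fun e => hzn.1 (hinj hx hz e).symm)
      (fun e => hzn.2 (hinj hy hz e).symm) (hch z hz x hx) (hch z hz y hy)).mono ?_ ?_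
    · rintro w ⟨hw, h | h | h⟩
      · exact ⟨hw, x, hx, h.symm⟩
      · exact ⟨hw, y, hy, h.symm⟩
      · exact ⟨hw, z, hz, h.symm⟩
    · rintro w (rfl | rfl | rfl)
      exacts [hx, hy, hz]
  | succ r ih =>
    obtain ⟨J, hJ, hmax⟩ := Finset.exists_max_image
      (S.powerset.filter fun J : Finset V => G.IsIndepSet (J : Set V)) Finset.card ⟨∅, by simp⟩
    simp only [Finset.mem_filter, Finset.mem_powerset] at hJ hmax
    obtain ⟨hJS, hJi⟩ := hJ
    have hJβ := hα J hJS hJi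
    have hdom : ∀ x ∈ S \ J, ∃ y ∈ J, G.Adj y x := by
      intro x hx
      rw [Finset.mem_sdiff] at hx
      by_contra hcon
      push Not at hcon
      have h1 := hmax (insert x J) ⟨Finset.insert_subset hx.1 hJS, by
        rw [Finset.coe_insert]
        refine Set.Pairwise.insert hJi fun y hy _ => ⟨fun h => hcon y hy h.symm, hcon y hy⟩⟩
      rw [Finset.card_insert_of_notMem hx.2] at h1
      omega
    have hsub : S \ J ⊆ S := Finset.sdiff_subset
    have hcard' : r * β + β + 1 ≤ (S \ J).card := by
      have := Finset.card_sdiff_add_card_eq_card hJS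
      have : (r + 1) * β = r * β + β := by ring
      omega
    have hJne : J.Nonempty := by
      obtain ⟨x, hx⟩ : (S \ J).Nonempty := Finset.card_pos.1 (by omega)
      obtain ⟨y, hy, -⟩ := hdom x hx
      exact ⟨y, hy⟩
    have hcol : ∀ z, (∃ x ∈ (J : Set V), ∃ y ∈ (J : Set V),
        (G.kempe v c (c x) (c y)).Reachable x z) → z ≠ v ∧ c z ∈ c '' J := by
      rintro z ⟨x, hx, y, hy, h⟩
      obtain ⟨h1, h2 | h2⟩ := kempe_reachable_imp le_rfl ⟨hSv x (hJS hx), Or.inl rfl⟩ h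
      · exact ⟨h1, x, hx, h2.symm⟩
      · exact ⟨h1, y, hy, h2.symm⟩
    refine (ih (S \ J) (fun x hx => hSv x (hsub hx)) (hinj.mono (by exact_mod_cast hsub))
      (fun x hx y hy => hch x (hsub hx) y (hsub hy)) (fun K hK => hα K (hK.trans hsub))
      hcard').extend ?_ (by exact_mod_cast hsub)
      (connected_induce_kempe (J := (J : Set V)) hJne
        fun x hx y hy => hch x (hJS hx) y (hJS hy)) ?_ ?_ ?_ ?_
    · exact fun z hz => ⟨hz.1, Set.image_mono (by exact_mod_cast hsub) hz.2⟩
    · exact fun z hz => ⟨(hcol z hz).1, Set.image_mono (by exact_mod_cast hJS) (hcol z hz).2⟩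
    · obtain ⟨u, hu⟩ := hJne
      exact ⟨u, ⟨u, hu, u, hu, Reachable.refl _⟩, hJS hu⟩
    · rw [Set.disjoint_left]
      rintro z hz ⟨-, y, hy, hyz⟩
      obtain ⟨-, x, hx, hxz⟩ := hcol z hz
      have hy' := Finset.mem_sdiff.1 (Finset.mem_coe.1 hy)
      have : x = y := hinj (hJS hx) hy'.1 (hxz.trans hyz.symm)
      exact hy'.2 (this ▸ hx)
    · intro x hx
      obtain ⟨y, hy, hyx⟩ := hdom x hx
      exact ⟨y, ⟨y, hy, y, hy, Reachable.refl _⟩, hyx⟩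

theorem CliqueModel.add_apex {G : SimpleGraph V} {n : ℕ} {A T : Set V} {v : V}
    (h : G.CliqueModel n A T) (hA : v ∉ A) (hT : ∀ x ∈ T, G.Adj v x) :
    G.CliqueModel (n + 1) Set.univ Set.univ :=
  h.extend (C := {v}) (by simp) (by simp) (connected_induce_singleton_s4 G v) (by simp)
    ⟨v, by simp⟩ (by simpa using hA) (fun x hx => ⟨v, rfl, hT x hx⟩)

theorem KMinorFree.of_isMinorOf {W : Type*} {G' : SimpleGraph W} {G : SimpleGraph V} {n : ℕ}
    (h : G.KMinorFree n) (hG' : G'.IsMinorOf G) : G'.KMinorFree n :=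
  fun h' => h (h'.trans hG')

theorem KMinorFree.mono {G : SimpleGraph V} {m n : ℕ} (hmn : m ≤ n) (h : G.KMinorFree m) :
    G.KMinorFree n := by
  rintro ⟨B, hB, hBc, hBd, hBa⟩
  refine h ⟨B ∘ Fin.castLE hmn, fun _ => hB _, fun _ => hBc _,
    fun i j hij => hBd ((Fin.castLE_injective hmn).ne hij), fun i j hij => hBa ?_⟩
  exact (Fin.castLE_injective hmn).ne hij

/-- Contracting `v` together with an independent set `I` of its neighbours and colouring the
result gives a colouring of `G - v` which is constant on `I`. -/
theorem exists_coloring_off_vertex {V : Type} [Fintype V] {G : SimpleGraph V} {n k : ℕ}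
    (hk : 1 ≤ k) (hG : G.KMinorFree n)
    (ih : ∀ (W : Type) [Fintype W] (G' : SimpleGraph W),
      Fintype.card W < Fintype.card V → G'.KMinorFree n → G'.Colorable k)
    (v : V) (I : Set V) (hI : ∀ x ∈ I, G.Adj v x) (hind : G.IsIndepSet I) :
    ∃ c : V → Fin k, (∀ x y, x ≠ v → y ≠ v → G.Adj x y → c x ≠ c y) ∧
      ∀ x ∈ I, ∀ y ∈ I, c x = c y := by
  classical
  obtain ⟨u, hu⟩ : ∃ u, I.Nonempty → u ∈ I := by
    by_cases h : I.Nonempty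
    · exact ⟨h.some, fun h' => h.some_mem⟩
    · exact ⟨v, fun h' => absurd h' h⟩
  let W := {x : V // x ≠ v ∧ (x ∈ I → x = u)}
  let B : W → Set V := fun w => if w.1 ∈ I then insert v I else {w.1}
  have hBself : ∀ w, w.1 ∈ B w := by
    intro w
    by_cases h : w.1 ∈ I <;> simp [B, h]
  have hBmem : ∀ w x, x ≠ v → x ∈ B w → (x ∈ I ∧ w.1 = u) ∨ (x ∉ I ∧ x = w.1) := by
    intro w x hx hxw
    by_cases h : w.1 ∈ I
    · simp only [B, h, if_true, Set.mem_insert_iff, hx, false_or] at hxw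
      exact Or.inl ⟨hxw, w.2.2 h⟩
    · simp only [B, h, if_false, Set.mem_singleton_iff] at hxw
      exact Or.inr ⟨hxw ▸ h, hxw⟩
  have hBd : ∀ w₁ w₂ x, x ∈ B w₁ → x ∈ B w₂ → w₁ = w₂ := by
    intro w₁ w₂ x h₁ h₂
    apply Subtype.ext
    by_cases hx : x = v
    · have key : ∀ w, x ∈ B w → w.1 = u := by
        intro w hw
        by_cases h : w.1 ∈ I
        · exact w.2.2 h
        · simp only [B, h, if_false, Set.mem_singleton_iff] at hw
          exact absurd (hw.symm.trans hx) w.2.1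
      rw [key _ h₁, key _ h₂]
    · rcases hBmem _ _ hx h₁ with h | h <;> rcases hBmem _ _ hx h₂ with h' | h'
      · rw [h.2, h'.2]
      · exact absurd h.1 h'.1
      · exact absurd h'.1 h.1
      · rw [← h.2, ← h'.2]
  have hBex : ∀ x, x ≠ v → ∃ w, x ∈ B w := by
    intro x hx
    by_cases h : x ∈ I
    · have huI := hu ⟨x, h⟩
      exact ⟨⟨u, (hI u huI).ne', fun _ => rfl⟩, by simp [B, huI, h]⟩
    · exact ⟨⟨x, hx, fun h' => absurd h' h⟩, by simp [B, h]⟩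
  let G' : SimpleGraph W :=
    { Adj := fun a b => a ≠ b ∧ ∃ x ∈ B a, ∃ y ∈ B b, G.Adj x y
      symm := ⟨fun a b ⟨h, x, hx, y, hy, hxy⟩ => ⟨h.symm, y, hy, x, hx, hxy.symm⟩⟩
      loopless := ⟨fun a h => h.1 rfl⟩ }
  have hmin : G'.IsMinorOf G := by
    refine ⟨B, fun w => ⟨_, hBself w⟩, fun w => ?_,
      fun w₁ w₂ hw => Set.disjoint_left.2 fun x h₁ h₂ => hw (hBd _ _ x h₁ h₂), fun _ _ h => h.2⟩
    by_cases h : w.1 ∈ I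
    · rw [show B w = insert v I from if_pos h]
      refine connected_induce_of_walks v (by simp) ?_
      rintro z (rfl | hz)
      · exact ⟨Walk.nil, by simp⟩
      · exact ⟨Walk.cons (hI z hz) Walk.nil, by simp [hz]⟩
    · rw [show B w = {w.1} from if_neg h]
      exact connected_induce_singleton_s4 G _
  obtain ⟨c'⟩ := ih W G' (Fintype.card_subtype_lt (x := v) (by simp)) (hG.of_isMinorOf hmin)
  have : ∀ x, ∃ a : Fin k, ∀ w : W, x ∈ B w → c' w = a := by
    intro x
    by_cases h : ∃ w, x ∈ B w
    · obtain ⟨w, hw⟩ := h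
      exact ⟨c' w, fun w' hw' => by rw [hBd w' w x hw' hw]⟩
    · exact ⟨⟨0, hk⟩, fun w hw => absurd ⟨w, hw⟩ h⟩
  choose c hc using this
  refine ⟨c, fun x y hx hy hxy => ?_, fun x hx y hy => ?_⟩
  · obtain ⟨a, ha⟩ := hBex x hx
    obtain ⟨b, hb⟩ := hBex y hy
    rw [← hc x a ha, ← hc y b hb]
    refine c'.valid ⟨?_, x, ha, y, hb, hxy⟩
    rintro rfl
    rcases hBmem _ _ hx ha with h | h <;> rcases hBmem _ _ hy hb with h' | h'
    · exact hind h.1 h'.1 hxy.ne hxy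
    · exact h'.1 (by rw [h'.2, h.2]; exact hu ⟨x, h.1⟩)
    · exact h.1 (by rw [h.2, h'.2]; exact hu ⟨y, h'.1⟩)
    · exact hxy.ne (h.2.trans h'.2.symm)
  · have huI := hu ⟨x, hx⟩
    let w : W := ⟨u, (hI u huI).ne', fun _ => rfl⟩
    rw [← hc x w (by simp [B, w, huI, hx]), ← hc y w (by simp [B, w, huI, hy])]

/-- If a `k`-colouring of `N` uses every colour and is constant on `I ⊆ N`, then many points of
`N` are the only ones of their colour. -/
theorem exists_singly_coloured {k : ℕ} {V : Type*} (N I : Finset V) (c : V → Fin k)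
    (hIN : I ⊆ N) (i₀ : Fin k) (hI : ∀ x ∈ I, c x = i₀) (hsurj : ∀ i, ∃ x ∈ N, c x = i) :
    k + I.card ≤ N.card + 1 ∧ ∃ S ⊆ N, (∀ x ∈ S, ∀ y ∈ N, c y = c x → y = x) ∧
      2 * k + I.card ≤ N.card + 2 + S.card := by
  classical
  set S := N.filter fun x => ∀ y ∈ N, c y = c x → y = x
  set f : Fin k → ℕ := fun i => (N.filter fun x => c x = i).card
  have hN : N.card = f i₀ + ∑ i ∈ Finset.univ.erase i₀, f i := by
    rw [Finset.add_sum_erase _ _ (Finset.mem_univ i₀)]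
    exact Finset.card_eq_sum_card_fiberwise fun x _ => Finset.mem_coe.2 (Finset.mem_univ _)
  have h0 : I.card ≤ f i₀ :=
    Finset.card_le_card fun x hx => Finset.mem_filter.2 ⟨hIN hx, hI x hx⟩
  have hk : (Finset.univ.erase i₀).card + 1 = k := by
    rw [Finset.card_erase_add_one (Finset.mem_univ _), Finset.card_univ, Fintype.card_fin]
  have h1 : ∀ i, 1 ≤ f i := fun i => by
    obtain ⟨x, hx, hxi⟩ := hsurj i
    exact Finset.card_pos.2 ⟨x, Finset.mem_filter.2 ⟨hx, hxi⟩⟩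
  have h2 : ∀ i, 2 ≤ f i + if i ∈ S.image c then 1 else 0 := by
    intro i
    by_cases hi : i ∈ S.image c
    · simpa [hi] using h1 i
    · simp only [hi, if_false, add_zero]
      by_contra hlt
      have hfi : f i = 1 := by have := h1 i; omega
      obtain ⟨x, hx⟩ := Finset.card_eq_one.1 hfi
      have hxm : x ∈ N.filter fun x => c x = i := by rw [hx]; simp
      rw [Finset.mem_filter] at hxm
      refine hi (Finset.mem_image.2 ⟨x, Finset.mem_filter.2 ⟨hxm.1, fun y hy hyx => ?_⟩, hxm.2⟩)
      have : y ∈ N.filter fun x => c x = i := Finset.mem_filter.2 ⟨hy, hyx.trans hxm.2⟩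
      rw [hx] at this
      simpa using this
  have s1 : (Finset.univ.erase i₀).card ≤ ∑ i ∈ Finset.univ.erase i₀, f i := by
    simpa using Finset.card_nsmul_le_sum (Finset.univ.erase i₀) f 1 fun i _ => h1 i
  have s2 := Finset.card_nsmul_le_sum (Finset.univ.erase i₀) _ 2 fun i _ => h2 i
  rw [Finset.sum_add_distrib, smul_eq_mul] at s2
  have s3 : (∑ i ∈ Finset.univ.erase i₀, if i ∈ S.image c then 1 else 0) ≤ S.card := by
    rw [← Finset.sum_filter, ← Finset.card_eq_sum_ones]
    exact (Finset.card_le_card fun i hi => (Finset.mem_filter.1 hi).2).trans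
      (Finset.card_image_le (s := S) (f := c))
  exact ⟨by omega, S, Finset.filter_subset _ _, fun x hx => (Finset.mem_filter.1 hx).2, by omega⟩

theorem KMinorFree.colorable {t δ k : ℕ} (ht : 6 ≤ t) (hk : 1 ≤ k)
    (hδ : ∀ (V : Type) [Fintype V] (G : SimpleGraph V) [DecidableRel G.Adj],
      G.KMinorFree (t + 1) → G.minDegree ≤ δ)
    (hkδ : (2 * (δ : ℤ) + 1 - 2 * k) * (2 * t - 7) < 2 * δ - 5)
    {V : Type} [Fintype V] {G : SimpleGraph V} (hG : G.KMinorFree (t + 1)) : G.Colorable k := by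
  classical
  induction hn : Fintype.card V using Nat.strong_induction_on generalizing V with
  | _ n ih =>
  subst hn
  rcases isEmpty_or_nonempty V with hV | hV
  · exact .of_isEmpty k
  obtain ⟨v, hv⟩ := G.exists_minimal_degree_vertex
  have hd : (G.neighborFinset v).card ≤ δ := by
    rw [card_neighborFinset_eq_degree, ← hv]
    exact hδ V G hG
  set N := G.neighborFinset v with hN
  have hNadj : ∀ x, x ∈ N ↔ G.Adj v x := fun x => by simp [hN]
  obtain ⟨I, hI, hmax⟩ := Finset.exists_max_image
    (N.powerset.filter fun J : Finset V => G.IsIndepSet (J : Set V)) Finset.card ⟨∅, by simp⟩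
  simp only [Finset.mem_filter, Finset.mem_powerset] at hI hmax
  obtain ⟨c, hc, hcI⟩ := exists_coloring_off_vertex hk hG
    (fun W _ G' hW hG' => ih _ hW hG' rfl) v (I : Set V)
    (fun x hx => (hNadj x).1 (hI.1 hx)) hI.2
  by_contra hcol
  have hsurj : ∀ i, ∃ x ∈ N, c x = i := by
    by_contra! hcon
    obtain ⟨i, hi⟩ := hcon
    refine hcol ⟨Coloring.mk (fun z => if z = v then i else c z) fun {a b} hab => ?_⟩
    by_cases ha : a = v <;> by_cases hb : b = v
    · exact absurd (ha.trans hb.symm) hab.ne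
    · subst ha; simpa [hb] using (hi b ((hNadj b).2 hab)).symm
    · subst hb; simpa [ha] using hi a ((hNadj a).2 hab.symm)
    · simpa [ha, hb] using hc a b ha hb hab
  obtain ⟨x₀, hx₀, -⟩ := hsurj ⟨0, hk⟩
  obtain ⟨u, hu⟩ : I.Nonempty := by
    have := hmax {x₀} ⟨by simpa using hx₀, by simp⟩
    rw [Finset.card_singleton] at this
    exact Finset.card_pos.1 this
  obtain ⟨hq, S, hSN, hS1, hS⟩ :=
    exists_singly_coloured N I c hI.1 (c u) (fun x hx => hcI x hx u hu) hsurj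
  have hkN : (2 * (N.card : ℤ) + 1 - 2 * k) * (2 * t - 7) < 2 * N.card - 5 := by
    have h1 : (0 : ℤ) ≤ (δ - N.card) := by omega
    have h2 : (0 : ℤ) ≤ 2 * t - 8 := by omega
    nlinarith [mul_nonneg h1 h2]
  obtain ⟨q, hq'⟩ : ∃ q : ℕ, N.card = k + q := Nat.exists_eq_add_of_le (by
    have := Finset.card_pos.2 ⟨u, hu⟩
    omega)
  obtain ⟨r, rfl⟩ := Nat.exists_eq_add_of_le ht
  rw [hq'] at hkN hq hS
  push_cast at hkN
  have hkq : 2 * ((q : ℤ) * r) + 4 * q + r + 6 ≤ k := by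
    have : 2 * (2 * ((q : ℤ) * r) + 4 * q + r + 5) < 2 * k := by linarith
    omega
  have hIpos := Finset.card_pos.2 ⟨u, hu⟩
  rcases Nat.lt_or_ge 1 I.card with hβ | hβ
  · have hcardS : (r + 3) * I.card + I.card + 1 ≤ S.card := by
      have h1 : 0 ≤ (q + 1 - I.card : ℤ) * (r + 3) :=
        mul_nonneg (by omega) (by omega)
      have h2 : (0 : ℤ) ≤ q * r := by positivity
      have h3 : 2 * (k : ℤ) + I.card ≤ k + q + 2 + S.card := by exact_mod_cast hS
      zify
      linarith
    have hSv : ∀ x ∈ S, x ≠ v := fun x hx => ((hNadj x).1 (hSN hx)).ne'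
    have hSu : ∀ x ∈ S, ∀ z, G.Adj v z → c z = c x → z = x := fun x hx z hz =>
      hS1 x hx z ((hNadj z).2 hz)
    refine ((cliqueModel_of_kempe (v := v) (c := c) hβ (r + 3) S hSv
      (fun x hx y hy e => hSu y hy x ((hNadj x).1 (hSN hx)) e)
      (fun x hx y hy => kempe_reachable_of_not_colorable hcol hc (hSu x hx) (hSu y hy))
      (fun J hJ hJi => hmax J ⟨hJ.trans hSN, hJi⟩) hcardS).add_apex (v := v) (fun h => h.1 rfl)
      (fun x hx => (hNadj x).1 (hSN hx))).not_kMinorFree (hG.mono ?_)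
    omega
  · have hcl : G.IsClique (N : Set V) := by
      intro x hx y hy hxy
      by_contra hadj
      have := hmax {x, y} ⟨by
        intro z hz
        rw [Finset.mem_insert, Finset.mem_singleton] at hz
        rcases hz with rfl | rfl
        exacts [hx, hy], by
        rw [Finset.coe_pair]
        exact Set.pairwise_pair.2 fun _ => ⟨hadj, fun h => hadj h.symm⟩⟩
      rw [Finset.card_pair hxy] at this
      omega
    refine ((hcl.cliqueModel N).add_apex (v := v) (by simp [hN])
      (fun x hx => (hNadj x).1 hx)).not_kMinorFree (hG.mono ?_)
    rw [hq']
    have h2 : (0 : ℤ) ≤ q * r := by positivity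
    zify
    linarith

end SimpleGraph

/-- If every `K_{t+1}`-minor-free graph (`t ≥ 6`) has minimum degree at most `δ`,
then every `K_{t+1}`-minor-free graph `G` satisfies
`χ(G) ≤ δ - (2δ - 5)/(4t - 14) + 3/2`. -/
theorem chromatic_bound_one (t δ : ℕ) (ht : 6 ≤ t)
    (hδ : ∀ (V : Type) [Fintype V] (G : SimpleGraph V) [DecidableRel G.Adj],
      G.KMinorFree (t + 1) → G.minDegree ≤ δ)
    (V : Type) [Fintype V] (G : SimpleGraph V) (hG : G.KMinorFree (t + 1)) :
    (G.chromaticNumber.toNat : ℝ) ≤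
      (δ : ℝ) - (2 * (δ : ℝ) - 5) / (4 * (t : ℝ) - 14) + 3 / 2 := by
  have hden : (0 : ℝ) < 4 * t - 14 := by
    have : (6 : ℝ) ≤ t := by exact_mod_cast ht
    linarith
  set R : ℝ := (δ : ℝ) - (2 * (δ : ℝ) - 5) / (4 * (t : ℝ) - 14) + 3 / 2 with hR
  have hR1 : 1 ≤ R := by
    have : (2 * (δ : ℝ) - 5) / (4 * (t : ℝ) - 14) ≤ δ + 1 / 2 := by
      rw [div_le_iff₀ hden]
      have : (6 : ℝ) ≤ t := by exact_mod_cast ht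
      nlinarith [Nat.cast_nonneg (α := ℝ) δ]
    linarith
  have hk : 1 ≤ ⌊R⌋₊ := Nat.le_floor (by exact_mod_cast hR1)
  have hlt : R < ⌊R⌋₊ + 1 := Nat.lt_floor_add_one R
  have hkδ : (2 * (δ : ℤ) + 1 - 2 * ⌊R⌋₊) * (2 * t - 7) < 2 * δ - 5 := by
    have h : (δ : ℝ) + 1 / 2 - ⌊R⌋₊ < (2 * (δ : ℝ) - 5) / (4 * (t : ℝ) - 14) := by linarith
    rw [lt_div_iff₀ hden] at h
    have h' : (2 * (δ : ℝ) + 1 - 2 * ⌊R⌋₊) * (2 * t - 7) < 2 * δ - 5 := by linarith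
    exact_mod_cast h'
  have hcol := hG.colorable ht hk hδ hkδ
  have hle : G.chromaticNumber.toNat ≤ ⌊R⌋₊ := ENat.toNat_le_of_le_natCast hcol.chromaticNumber_le
  exact (Nat.cast_le.2 hle).trans (Nat.floor_le (by linarith))
end
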